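/- arXiv:1805.07194 — 3 statements merged into one kernel-verified Lean document; each statement's English description precedes it below -/
import Mathlib

section
/- Let Δ be a p×p real symmetric matrix and γ > 0, and consider s := sup { Tr(B²Δ) + 2γ·Tr(B) : B a p×p real symmetric positive semidefinite matrix }. If Δ is not negative definite, then s = +∞. If Δ is negative definite, then s = −γ²·Tr(Δ⁻¹) and the supremum is attained by the unique maximizer B⋆ = −γ·Δ⁻¹. -/
open Matrix

/-- A positive definite `M` gives a definite form `D ↦ Tr(D M Dᵀ)` on matrices. -/
theorem Matrix.PosDef.eq_zero_of_trace_mul_mul_transpose_eq_zero {m n : Type*}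
    [Fintype m] [Fintype n] {M : Matrix n n ℝ} (hM : M.PosDef) {D : Matrix m n ℝ}
    (h : (D * M * Dᵀ).trace = 0) : D = 0 := by
  have hdiag : ∀ i, (D * M * Dᵀ) i i = D i ⬝ᵥ (M *ᵥ D i) := fun i => by
    rw [dotProduct_mulVec]
    rfl
  have hnonneg : ∀ i ∈ Finset.univ, 0 ≤ (D * M * Dᵀ) i i := fun i _ => by
    rw [hdiag]
    simpa using hM.posSemidef.dotProduct_mulVec_nonneg (D i)
  ext i j
  by_contra hij
  have hpos := hM.dotProduct_mulVec_pos (x := D i) (fun h0 => hij (congrFun h0 j))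
  have hzero := (Finset.sum_eq_zero_iff_of_nonneg hnonneg).1 h i (Finset.mem_univ i)
  rw [hdiag] at hzero
  simp only [star_trivial] at hpos
  exact hpos.ne' hzero

/-- Completing the square in the quadratic trace objective. -/
theorem Matrix.trace_objective_eq_square_sub {n : Type*} [Fintype n] [DecidableEq n]
    {Δ : Matrix n n ℝ} (hΔ : IsUnit Δ.det) (γ : ℝ) (B : Matrix n n ℝ) :
    (B * B * Δ).trace + 2 * γ * B.trace
      = ((B + γ • Δ⁻¹) * Δ * (B + γ • Δ⁻¹)).trace - γ ^ 2 * Δ⁻¹.trace := by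
  have hexp : (B + γ • Δ⁻¹) * Δ * (B + γ • Δ⁻¹)
      = B * Δ * B + γ • B + γ • B + (γ * γ) • Δ⁻¹ := by
    simp only [add_mul, mul_add, Matrix.smul_mul, Matrix.mul_smul, nonsing_inv_mul _ hΔ,
      mul_nonsing_inv_cancel_right _ _ hΔ, Matrix.one_mul, smul_smul]
    abel
  rw [hexp]
  simp only [trace_add, trace_smul, smul_eq_mul, Matrix.trace_mul_cycle B Δ B]
  ring

/-- Value of the objective on the rank-one matrices `s • v vᵀ`. -/
theorem Matrix.trace_objective_smul_vecMulVec {n : Type*} [Fintype n]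
    (Δ : Matrix n n ℝ) (γ s : ℝ) (v : n → ℝ) :
    ((s • vecMulVec v v) * (s • vecMulVec v v) * Δ).trace + 2 * γ * (s • vecMulVec v v).trace
      = s ^ 2 * (v ⬝ᵥ v) * (v ⬝ᵥ (Δ *ᵥ v)) + 2 * γ * s * (v ⬝ᵥ v) := by
  have htrace : (vecMulVec v v * Δ).trace = v ⬝ᵥ (Δ *ᵥ v) := by
    rw [vecMulVec_mul, trace_vecMulVec, dotProduct_comm, dotProduct_mulVec]
  have hsq : vecMulVec v v * vecMulVec v v = (v ⬝ᵥ v) • vecMulVec v v := by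
    rw [vecMulVec_mul_vecMulVec, vecMulVec_smul]
  simp only [Matrix.smul_mul, Matrix.mul_smul, hsq, trace_smul, smul_eq_mul, htrace,
    trace_vecMulVec]
  ring

/-- For a symmetric `Δ` and `γ > 0`, consider
`s = sup { Tr(B²Δ) + 2γ Tr(B) : B positive semidefinite }` (in `EReal`).
If `Δ` is not negative definite (i.e. `−Δ` is not positive definite) then
`s = +∞`; if `Δ` is negative definite then `s = −γ² Tr(Δ⁻¹)` and the supremum
is attained by the unique maximizer `B⋆ = −γ·Δ⁻¹`. -/
theorem sup_quadratic_trace_objective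
    {p : ℕ} (hp : 1 ≤ p)
    (Δ : Matrix (Fin p) (Fin p) ℝ) (hΔ : Δ.IsSymm)
    (γ : ℝ) (hγ : 0 < γ) :
    (¬ (-Δ).PosDef →
      sSup {t : EReal | ∃ B : Matrix (Fin p) (Fin p) ℝ, B.PosSemidef ∧
          t = (((B * B * Δ).trace + 2 * γ * B.trace : ℝ) : EReal)} = ⊤) ∧
    ((-Δ).PosDef →
      sSup {t : EReal | ∃ B : Matrix (Fin p) (Fin p) ℝ, B.PosSemidef ∧
          t = (((B * B * Δ).trace + 2 * γ * B.trace : ℝ) : EReal)}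
        = ((-γ ^ 2 * Δ⁻¹.trace : ℝ) : EReal) ∧
      ((-γ) • Δ⁻¹).PosSemidef ∧
      (((-γ) • Δ⁻¹) * ((-γ) • Δ⁻¹) * Δ).trace + 2 * γ * ((-γ) • Δ⁻¹).trace
        = -γ ^ 2 * Δ⁻¹.trace ∧
      (∀ B : Matrix (Fin p) (Fin p) ℝ, B.PosSemidef →
        (B * B * Δ).trace + 2 * γ * B.trace = -γ ^ 2 * Δ⁻¹.trace →
        B = (-γ) • Δ⁻¹)) := by
  refine ⟨fun hneg => ?_, fun hpos => ?_⟩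
  · obtain ⟨v, hv, hvΔ⟩ : ∃ v : Fin p → ℝ, v ≠ 0 ∧ 0 ≤ v ⬝ᵥ (Δ *ᵥ v) := by
      by_contra! hcon
      refine hneg (PosDef.of_dotProduct_mulVec_pos (by simpa using hΔ.neg) fun {v} hv => ?_)
      simpa [neg_mulVec] using hcon v hv
    have hvv : 0 < v ⬝ᵥ v := by simpa using dotProduct_star_self_pos_iff.2 hv
    refine EReal.eq_top_iff_forall_lt _ |>.2 fun y => ?_
    obtain ⟨s, hs⟩ := exists_gt (max 0 (y / (2 * γ * (v ⬝ᵥ v))))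
    obtain ⟨hs0, hsy⟩ := max_lt_iff.1 hs
    refine lt_of_lt_of_le ?_ (le_sSup ⟨s • vecMulVec v v, ?_, rfl⟩)
    · rw [EReal.coe_lt_coe_iff, trace_objective_smul_vecMulVec]
      rw [div_lt_iff₀ (by positivity)] at hsy
      have : 0 ≤ s ^ 2 * (v ⬝ᵥ v) * (v ⬝ᵥ (Δ *ᵥ v)) := by positivity
      linarith
    · simpa using (posSemidef_vecMulVec_self_star v).smul hs0.le
  · have hdet : IsUnit Δ.det := by
      have hunit := hpos.isUnit
      rwa [IsUnit.neg_iff, isUnit_iff_isUnit_det] at hunit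
    have hinv : (-Δ)⁻¹ = -Δ⁻¹ := inv_eq_right_inv (by simp [mul_nonsing_inv _ hdet])
    have hmaxPSD : ((-γ) • Δ⁻¹).PosSemidef := by
      simpa [hinv] using hpos.posSemidef.inv.smul hγ.le
    have hmaxVal : (((-γ) • Δ⁻¹) * ((-γ) • Δ⁻¹) * Δ).trace + 2 * γ * ((-γ) • Δ⁻¹).trace
        = -γ ^ 2 * Δ⁻¹.trace := by
      rw [trace_objective_eq_square_sub hdet]
      simp
    have hsymm : ∀ B : Matrix (Fin p) (Fin p) ℝ, B.PosSemidef →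
        (B + γ • Δ⁻¹)ᵀ = B + γ • Δ⁻¹ := fun B hB => by
      have hBt : Bᵀ = B := by simpa using hB.isHermitian.eq
      rw [transpose_add, transpose_smul, transpose_nonsing_inv, hΔ.eq, hBt]
    refine ⟨le_antisymm (sSup_le ?_) (le_sSup ⟨_, hmaxPSD, by rw [hmaxVal]⟩),
      hmaxPSD, hmaxVal, fun B hB hval => ?_⟩
    · rintro _ ⟨B, hB, rfl⟩
      rw [EReal.coe_le_coe_iff, trace_objective_eq_square_sub hdet]
      have hnonneg := (hpos.posSemidef.mul_mul_conjTranspose_same (B + γ • Δ⁻¹)).trace_nonneg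
      rw [conjTranspose_eq_transpose_of_trivial, hsymm B hB, Matrix.mul_neg, Matrix.neg_mul,
        trace_neg] at hnonneg
      linarith
    · rw [trace_objective_eq_square_sub hdet] at hval
      have hzero := hpos.eq_zero_of_trace_mul_mul_transpose_eq_zero (D := B + γ • Δ⁻¹) (by
        rw [hsymm B hB, Matrix.mul_neg, Matrix.neg_mul, trace_neg]
        linarith)
      rw [neg_smul]
      exact eq_neg_of_add_eq_zero_left hzero
end

section
/- Fix ρ > 0 and nonnegative reals λ₁, …, λ_p. The function φ(γ) := (ρ² − ½·Σᵢ₌₁ᵖ λᵢ)·γ − p + ½·Σᵢ₌₁ᵖ √(λᵢ²γ² + 4λᵢγ) is strictly increasing on [0, ∞) and has a unique zero γ⋆ in (0, ∞). -/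
/-- The function `x ↦ √(x² + 4x) - x` is nondecreasing on `[0, ∞)`. -/
theorem sqrt_sq_add_four_mul_sub_self_monotoneOn :
    MonotoneOn (fun x : ℝ => Real.sqrt (x ^ 2 + 4 * x) - x) (Set.Ici 0) := by
  intro x hx y _ hxy
  have hx0 : 0 ≤ x := hx
  have hs : Real.sqrt (x ^ 2 + 4 * x) ≤ x + 2 :=
    Real.sqrt_le_iff.mpr ⟨by linarith, by nlinarith⟩
  have hsq : Real.sqrt (x ^ 2 + 4 * x) ^ 2 = x ^ 2 + 4 * x :=
    Real.sq_sqrt (by positivity)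
  have h : Real.sqrt (x ^ 2 + 4 * x) + (y - x) ≤ Real.sqrt (y ^ 2 + 4 * y) := by
    apply Real.le_sqrt_of_sq_le
    nlinarith [mul_le_mul_of_nonneg_left hs (sub_nonneg.mpr hxy)]
  show Real.sqrt (x ^ 2 + 4 * x) - x ≤ Real.sqrt (y ^ 2 + 4 * y) - y
  linarith

/-- For `ρ > 0` and nonnegative reals `λ₁, …, λ_p`, the
function `φ(γ) = (ρ² − ½ Σ λᵢ) γ − p + ½ Σ √(λᵢ²γ² + 4λᵢγ)` is strictly
increasing on `[0, ∞)` and has a unique zero in `(0, ∞)`. -/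
theorem phi_strictMono_and_unique_zero
    {p : ℕ} (hp : 1 ≤ p) (ρ : ℝ) (hρ : 0 < ρ)
    (lam : Fin p → ℝ) (hlam : ∀ i, 0 ≤ lam i) :
    StrictMonoOn
      (fun γ : ℝ => (ρ ^ 2 - (∑ i, lam i) / 2) * γ - p
        + (∑ i, Real.sqrt ((lam i) ^ 2 * γ ^ 2 + 4 * lam i * γ)) / 2)
      (Set.Ici 0) ∧
    ∃! γ : ℝ, 0 < γ ∧
      (ρ ^ 2 - (∑ i, lam i) / 2) * γ - p
        + (∑ i, Real.sqrt ((lam i) ^ 2 * γ ^ 2 + 4 * lam i * γ)) / 2 = 0 := by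
  set φ : ℝ → ℝ := fun γ => (ρ ^ 2 - (∑ i, lam i) / 2) * γ - p
    + (∑ i, Real.sqrt ((lam i) ^ 2 * γ ^ 2 + 4 * lam i * γ)) / 2 with hφ
  have hφ_eq : ∀ γ, φ γ = ρ ^ 2 * γ - p
      + (∑ i, (Real.sqrt ((lam i * γ) ^ 2 + 4 * (lam i * γ)) - lam i * γ)) / 2 := by
    intro γ
    simp only [hφ, Finset.sum_sub_distrib, ← Finset.sum_mul, mul_pow, mul_assoc]
    ring
  have hmono : StrictMonoOn φ (Set.Ici 0) := by
    intro x hx y hy hxy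
    have hsum : ∑ i, (Real.sqrt ((lam i * x) ^ 2 + 4 * (lam i * x)) - lam i * x)
        ≤ ∑ i, (Real.sqrt ((lam i * y) ^ 2 + 4 * (lam i * y)) - lam i * y) :=
      Finset.sum_le_sum fun i _ =>
        sqrt_sq_add_four_mul_sub_self_monotoneOn (mul_nonneg (hlam i) hx)
          (mul_nonneg (hlam i) hy) (mul_le_mul_of_nonneg_left hxy.le (hlam i))
    have hlin : ρ ^ 2 * x < ρ ^ 2 * y := mul_lt_mul_of_pos_left hxy (by positivity)
    rw [hφ_eq, hφ_eq]
    linarith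
  have hp_pos : (0 : ℝ) < p := by exact_mod_cast hp
  have hzero : φ 0 < 0 := by simpa [hφ] using Nat.pos_of_ne_zero (by omega)
  have hb : (0 : ℝ) ≤ p / ρ ^ 2 := by positivity
  have hnonneg : 0 ≤ φ (p / ρ ^ 2) := by
    have hsum : 0 ≤ ∑ i, (Real.sqrt ((lam i * (p / ρ ^ 2)) ^ 2 + 4 * (lam i * (p / ρ ^ 2)))
        - lam i * (p / ρ ^ 2)) := by
      refine Finset.sum_nonneg fun i _ => sub_nonneg.mpr (Real.le_sqrt_of_sq_le ?_)
      linarith [mul_nonneg (hlam i) hb]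
    have hlin : ρ ^ 2 * (p / ρ ^ 2) = p := by field_simp
    rw [hφ_eq]
    linarith
  have hcont : Continuous φ := by fun_prop
  obtain ⟨γ, hγ, hγ_zero⟩ :=
    intermediate_value_Icc hb hcont.continuousOn ⟨hzero.le, hnonneg⟩
  have hγ_ne : γ ≠ 0 := by
    rintro rfl
    exact hzero.ne hγ_zero
  refine ⟨hmono, γ, ⟨lt_of_le_of_ne hγ.1 hγ_ne.symm, hγ_zero⟩, ?_⟩
  rintro δ ⟨hδ, hδ_zero⟩
  exact hmono.injOn hδ.le hγ.1 (Eq.trans (b := (0 : ℝ)) hδ_zero hγ_zero.symm)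
end

section
/- Fix ρ > 0 and nonnegative reals λ₁, …, λ_p with λ_max := maxᵢ λᵢ, and let γ⋆ be the unique positive solution of (ρ² − ½·Σᵢ λᵢ)·γ − p + ½·Σᵢ √(λᵢ²γ² + 4λᵢγ) = 0. Then γ⋆ ≥ γ_min := (p²λ_max + 2pρ² − p·√(p²λ_max² + 4pρ²λ_max)) / (2ρ⁴) > 0 and γ⋆ ≤ p/ρ²; moreover, if λᵢ > 0 for all i, then additionally γ⋆ ≤ (1/ρ)·√(Σᵢ₌₁ᵖ 1/λᵢ). -/
/-- The smaller root of `t ^ 2 - (2 + x) * t + 1`. -/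
noncomputable def smallRoot (x : ℝ) : ℝ := 1 + x / 2 - Real.sqrt (x ^ 2 + 4 * x) / 2

lemma sqrt_sq_add_four_mul_lt {x : ℝ} (hx : 0 ≤ x) : Real.sqrt (x ^ 2 + 4 * x) < x + 2 := by
  rw [Real.sqrt_lt' (by linarith)]
  nlinarith

lemma le_sqrt_sq_add_four_mul {x : ℝ} (hx : 0 ≤ x) : x ≤ Real.sqrt (x ^ 2 + 4 * x) :=
  Real.le_sqrt_of_sq_le (by linarith)

lemma smallRoot_pos {x : ℝ} (hx : 0 ≤ x) : 0 < smallRoot x := by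
  have := sqrt_sq_add_four_mul_lt hx
  unfold smallRoot
  linarith

lemma smallRoot_le_one {x : ℝ} (hx : 0 ≤ x) : smallRoot x ≤ 1 := by
  have := le_sqrt_sq_add_four_mul hx
  unfold smallRoot
  linarith

lemma one_sub_smallRoot_sq {x : ℝ} (hx : 0 ≤ x) : (1 - smallRoot x) ^ 2 = x * smallRoot x := by
  have := Real.sq_sqrt (show 0 ≤ x ^ 2 + 4 * x by positivity)
  unfold smallRoot
  linear_combination this / 4

lemma smallRoot_le_one_div {x : ℝ} (hx : 0 < x) : smallRoot x ≤ 1 / x := by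
  rw [le_div_iff₀ hx]
  nlinarith [one_sub_smallRoot_sq hx.le, smallRoot_pos hx.le, smallRoot_le_one hx.le]

lemma smallRoot_anti {x y : ℝ} (hx : 0 ≤ x) (hxy : x ≤ y) : smallRoot y ≤ smallRoot x := by
  have hs := Real.sq_sqrt (show 0 ≤ x ^ 2 + 4 * x by positivity)
  have hlt := sqrt_sq_add_four_mul_lt hx
  have : Real.sqrt (x ^ 2 + 4 * x) + (y - x) ≤ Real.sqrt (y ^ 2 + 4 * y) := by
    apply Real.le_sqrt_of_sq_le
    nlinarith [mul_nonneg (sub_nonneg.2 hxy) (sub_nonneg.2 hlt.le)]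
  unfold smallRoot
  linarith

/-- Bounds for the unique positive solution `γ⋆` of
`(ρ² − ½ Σ λᵢ) γ − p + ½ Σ √(λᵢ²γ² + 4λᵢγ) = 0`:
`γ⋆ ≥ γ_min := (p²λ_max + 2pρ² − p√(p²λ_max² + 4pρ²λ_max)) / (2ρ⁴) > 0` and
`γ⋆ ≤ p/ρ²`; if moreover all `λᵢ > 0` then `γ⋆ ≤ (1/ρ)·√(Σᵢ 1/λᵢ)`. -/
theorem gamma_star_bounds
    {p : ℕ} (hp : 1 ≤ p) (ρ : ℝ) (hρ : 0 < ρ)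
    (lam : Fin p → ℝ) (hlam : ∀ i, 0 ≤ lam i)
    (lmax : ℝ) (hmax : IsGreatest (Set.range lam) lmax)
    (γs : ℝ) (hγpos : 0 < γs)
    (heq : (ρ ^ 2 - (∑ i, lam i) / 2) * γs - p
        + (∑ i, Real.sqrt ((lam i) ^ 2 * γs ^ 2 + 4 * lam i * γs)) / 2 = 0) :
    0 < (p ^ 2 * lmax + 2 * p * ρ ^ 2
          - p * Real.sqrt (p ^ 2 * lmax ^ 2 + 4 * p * ρ ^ 2 * lmax)) / (2 * ρ ^ 4) ∧
    (p ^ 2 * lmax + 2 * p * ρ ^ 2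
          - p * Real.sqrt (p ^ 2 * lmax ^ 2 + 4 * p * ρ ^ 2 * lmax)) / (2 * ρ ^ 4) ≤ γs ∧
    γs ≤ p / ρ ^ 2 ∧
    ((∀ i, 0 < lam i) → γs ≤ (1 / ρ) * Real.sqrt (∑ i, 1 / lam i)) := by
  have hp0 : (0 : ℝ) < p := by exact_mod_cast hp
  have hρ2 : 0 < ρ ^ 2 := by positivity
  have hL : 0 ≤ lmax := by
    obtain ⟨i, rfl⟩ := hmax.1
    exact hlam i
  have hsum : ρ ^ 2 * γs = ∑ i, smallRoot (lam i * γs) := by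
    have h : ∀ i, smallRoot (lam i * γs) = 1 + lam i * (γs / 2)
        - Real.sqrt ((lam i) ^ 2 * γs ^ 2 + 4 * lam i * γs) / 2 := by
      intro i
      unfold smallRoot
      rw [show (lam i * γs) ^ 2 + 4 * (lam i * γs)
        = (lam i) ^ 2 * γs ^ 2 + 4 * lam i * γs by ring]
      ring
    simp only [h, Finset.sum_sub_distrib, Finset.sum_add_distrib, ← Finset.sum_mul,
      ← Finset.sum_div, Finset.sum_const, Finset.card_univ, Fintype.card_fin, nsmul_eq_mul]
    linear_combination heq
  have hx : ∀ i, 0 ≤ lam i * γs := fun i => mul_nonneg (hlam i) hγpos.le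
  have hupper : γs ≤ p / ρ ^ 2 := by
    rw [le_div_iff₀ hρ2, mul_comm, hsum]
    calc ∑ i, smallRoot (lam i * γs) ≤ ∑ _i : Fin p, (1 : ℝ) :=
          Finset.sum_le_sum fun i _ => smallRoot_le_one (hx i)
      _ = p := by simp
  have hc : 0 ≤ lmax * (p / ρ ^ 2) := by positivity
  have hmin : (p ^ 2 * lmax + 2 * p * ρ ^ 2
      - p * Real.sqrt (p ^ 2 * lmax ^ 2 + 4 * p * ρ ^ 2 * lmax)) / (2 * ρ ^ 4)
      = p / ρ ^ 2 * smallRoot (lmax * (p / ρ ^ 2)) := by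
    have h : (p : ℝ) ^ 2 * lmax ^ 2 + 4 * p * ρ ^ 2 * lmax
        = (ρ ^ 2) ^ 2 * ((lmax * (p / ρ ^ 2)) ^ 2 + 4 * (lmax * (p / ρ ^ 2))) := by
      field_simp
    rw [h, Real.sqrt_mul (by positivity), Real.sqrt_sq hρ2.le]
    unfold smallRoot
    generalize Real.sqrt _ = s
    field_simp
    ring
  rw [hmin]
  refine ⟨mul_pos (by positivity) (smallRoot_pos hc), ?_, hupper, fun hpos => ?_⟩
  · rw [div_mul_eq_mul_div, div_le_iff₀ hρ2, mul_comm γs, hsum]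
    calc (p : ℝ) * smallRoot (lmax * (p / ρ ^ 2))
        = ∑ _i : Fin p, smallRoot (lmax * (p / ρ ^ 2)) := by simp
      _ ≤ ∑ i, smallRoot (lam i * γs) := Finset.sum_le_sum fun i _ =>
          smallRoot_anti (hx i) (mul_le_mul (hmax.2 ⟨i, rfl⟩) hupper hγpos.le hL)
  · rw [one_div_mul_eq_div, le_div_iff₀ hρ]
    apply Real.le_sqrt_of_sq_le
    calc (γs * ρ) ^ 2 = (∑ i, smallRoot (lam i * γs)) * γs := by rw [← hsum]; ring
      _ ≤ (∑ i, 1 / (lam i * γs)) * γs := by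
          gcongr with i
          exact smallRoot_le_one_div (mul_pos (hpos i) hγpos)
      _ = ∑ i, 1 / lam i := by
          rw [Finset.sum_mul]
          refine Finset.sum_congr rfl fun i _ => ?_
          have := (hpos i).ne'
          field_simp
end
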